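/- In a constraint network over {=, ≠, >} with Boolean domain {0,1}, if the subnetworks L₌ and L≠ of equality and disequality constraints are acyclic and the subnetwork L₍>₎ of strict inequality constraints is acyclic (as a directed graph modulo the equivalences), then any sequence of non-redundant constraint additions to the network has length at most 3n, where n is the number of variables. -/

import Mathlib

/-- Kinds of binary constraints over the language `{=, ≠, >}`. -/
inductive CKind : Type
  | ceq : CKind
  | cne : CKind
  | cgt : CKind

/-- Satisfaction of a binary constraint over the Boolean domain `{0,1}`
(`true` plays the role of `1`). -/
def holdsC {X : Type} (e : X → Bool) : CKind × X × X → Prop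
  | (CKind.ceq, i, j) => e i = e j
  | (CKind.cne, i, j) => e i ≠ e j
  | (CKind.cgt, i, j) => e i = true ∧ e j = false

/-- Vectors that can be separated from all later ones by a submodule are linearly independent. -/
theorem linearIndependent_of_separating_submodules {K V : Type*} [DivisionRing K]
    [AddCommGroup V] [Module K V] {k : ℕ} (v : Fin k → V) (S : Fin k → Submodule K V)
    (hnot : ∀ i, v i ∉ S i) (hmem : ∀ i j, i < j → v j ∈ S i) : LinearIndependent K v := by
  induction k with
  | zero => exact linearIndependent_empty_type
  | succ k ih =>
    refine linearIndependent_finSucc.2 ⟨ih (Fin.tail v) (Fin.tail S) (fun i => hnot i.succ)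
      fun i j hij => hmem i.succ j.succ (Fin.succ_lt_succ_iff.2 hij), fun hspan => hnot 0 ?_⟩
    refine Submodule.span_le.2 ?_ hspan
    rintro _ ⟨j, rfl⟩
    exact hmem 0 j.succ (Fin.succ_pos j)

/-- The homogeneous linear system over `ZMod 2` of a constraint, where the coordinate `none`
stands for the constant `1`. -/
def constraintSubmodule {X : Type} : CKind × X × X → Submodule (ZMod 2) (Option X → ZMod 2)
  | (CKind.ceq, i, j) =>
    LinearMap.ker (LinearMap.proj (R := ZMod 2) (φ := fun _ : Option X => ZMod 2) (some i) -
      LinearMap.proj (some j))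
  | (CKind.cne, i, j) =>
    LinearMap.ker (LinearMap.proj (R := ZMod 2) (φ := fun _ : Option X => ZMod 2) (some i) +
      LinearMap.proj (some j) - LinearMap.proj none)
  | (CKind.cgt, i, j) =>
    LinearMap.ker (LinearMap.proj (R := ZMod 2) (φ := fun _ : Option X => ZMod 2) (some i) -
      LinearMap.proj none) ⊓ LinearMap.ker (LinearMap.proj (some j))

/-- An assignment as a vector over `ZMod 2`, with the constant coordinate `none` set to `1`. -/
def homogenize {X : Type} (e : X → Bool) : Option X → ZMod 2
  | none => 1
  | some i => (e i).toNat

theorem homogenize_mem_constraintSubmodule_iff {X : Type} (e : X → Bool) (c : CKind × X × X) :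
    homogenize e ∈ constraintSubmodule c ↔ holdsC e c := by
  obtain ⟨_ | _ | _, i, j⟩ := c <;> cases hi : e i <;> cases hj : e j <;>
    simp [constraintSubmodule, homogenize, holdsC, hi, hj]

/-- Over the Boolean domain `{0,1}`, any sequence of constraint
additions over the language `{=, ≠, >}` on `n` variables in which each new
constraint is non-redundant with respect to the previously added ones (i.e.
some solution of the previous constraints violates it) has length at most `3n`. -/
theorem non_redundant_sequence_length_le_three_n
    (n k : ℕ) (cs : Fin k → CKind × Fin n × Fin n)
    (h : ∀ i : Fin k, ∃ e : Fin n → Bool,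
      (∀ j : Fin k, j < i → holdsC e (cs j)) ∧ ¬ holdsC e (cs i)) :
    k ≤ 3 * n := by
  rcases Nat.eq_zero_or_pos n with rfl | hn
  · by_contra hk
    exact (cs ⟨0, by omega⟩).2.1.elim0
  · choose e hsat hviol using h
    have hli : LinearIndependent (ZMod 2) fun i => homogenize (e i) :=
      linearIndependent_of_separating_submodules _ (fun i => constraintSubmodule (cs i))
        (fun i => mt (homogenize_mem_constraintSubmodule_iff _ _).1 (hviol i))
        fun i j hij => (homogenize_mem_constraintSubmodule_iff _ _).2 (hsat j i hij)
    have hcard : k ≤ n + 1 := by simpa using hli.fintype_card_le_finrank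
    omega
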